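/- For every finite abelian group G with exp(G) = n ≥ 3 and rank r, one has m(G) ≤ min{ n/2 + r − 2, max{ r − 1, 5n/6 − 4, (n + r − 3)/2 } }. -/

import Mathlib

/-- A sequence over `G₀` (a multiset with entries in `G₀`) with sum zero. -/
def IsZeroSumSeq {G : Type*} [AddCommGroup G] (G₀ : Set G) (S : Multiset G) : Prop :=
  (∀ g ∈ S, g ∈ G₀) ∧ S.sum = 0

/-- A minimal zero-sum sequence (atom) over `G₀`. -/
def IsAtomSeq {G : Type*} [AddCommGroup G] (G₀ : Set G) (A : Multiset G) : Prop :=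
  IsZeroSumSeq G₀ A ∧ A ≠ 0 ∧ ∀ B ≤ A, B ≠ 0 → B.sum = 0 → B = A

/-- The set of lengths of factorizations of `B` into atoms over `G₀`. -/
def LengthSet {G : Type*} [AddCommGroup G] (G₀ : Set G) (B : Multiset G) : Set ℕ :=
  {k | ∃ F : Multiset (Multiset G), F.card = k ∧ (∀ A ∈ F, IsAtomSeq G₀ A) ∧ F.sum = B}

/-- The set of successive distances of a set of naturals. -/
def DistSet (L : Set ℕ) : Set ℕ :=
  {d | ∃ a b, a ∈ L ∧ b ∈ L ∧ a < b ∧ b - a = d ∧ ∀ c ∈ L, ¬(a < c ∧ c < b)}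

/-- The set of distances `Δ(G₀)`. -/
def DeltaSet {G : Type*} [AddCommGroup G] (G₀ : Set G) : Set ℕ :=
  {d | ∃ B : Multiset G, IsZeroSumSeq G₀ B ∧ d ∈ DistSet (LengthSet G₀ B)}

/-- The cross number of a sequence. -/
noncomputable def crossNum {G : Type*} [AddCommGroup G] (S : Multiset G) : ℚ :=
  (S.map (fun g => (1 : ℚ) / addOrderOf g)).sum

/-- `G₀` is an LCN-set: every atom has cross number at least 1. -/
def IsLCNSet {G : Type*} [AddCommGroup G] (G₀ : Set G) : Prop :=
  ∀ A : Multiset G, IsAtomSeq G₀ A → 1 ≤ crossNum A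

/-- The set of minimal distances `Δ*(G)`. -/
def DeltaStar (G : Type*) [AddCommGroup G] : Set ℕ :=
  {d | ∃ G₀ : Set G, DeltaSet G₀ ≠ ∅ ∧ d = sInf (DeltaSet G₀)}

/-- `m(G)`: the maximum of `min Δ(G₀)` over non-half-factorial LCN-sets `G₀`. -/
noncomputable def mConst (G : Type*) [AddCommGroup G] : ℕ :=
  sSup {d | ∃ G₀ : Set G, IsLCNSet G₀ ∧ DeltaSet G₀ ≠ ∅ ∧ d = sInf (DeltaSet G₀)}

/-- The rank of a finite abelian group: the maximal `k` such that `(ZMod p)^k`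
embeds into `G` for some prime `p`. -/
noncomputable def grank (G : Type*) [AddCommGroup G] : ℕ :=
  sSup {k | ∃ p : ℕ, p.Prime ∧ ∃ f : (Fin k → ZMod p) →+ G, Function.Injective f}

/-- The system of sets of lengths `L(G)`. -/
def SystemSets (G : Type*) [AddCommGroup G] : Set (Set ℕ) :=
  {L | ∃ B : Multiset G, B.sum = 0 ∧ L = LengthSet Set.univ B}

/-- The Davenport constant: the maximal length of a minimal zero-sum sequence. -/
noncomputable def DavenportC (G : Type*) [AddCommGroup G] : ℕ :=
  sSup {k | ∃ A : Multiset G, IsAtomSeq (Set.univ : Set G) A ∧ A.card = k}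


theorem IsAtomSeq.mono {G : Type*} [AddCommGroup G] {S T : Set G} (h : S ⊆ T)
    {A : Multiset G} (hA : IsAtomSeq S A) : IsAtomSeq T A :=
  ⟨⟨fun g hg => h (hA.1.1 g hg), hA.1.2⟩, hA.2⟩

theorem exists_atomSeq_le {G : Type*} [AddCommGroup G] {S : Set G} (B : Multiset G)
    (hB : IsZeroSumSeq S B) (h0 : B ≠ 0) : ∃ A ≤ B, IsAtomSeq S A := by
  induction B using Multiset.strongInductionOn with
  | ih B ih =>
    by_cases hA : IsAtomSeq S B
    · exact ⟨B, le_rfl, hA⟩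
    · have : ∃ C ≤ B, C ≠ 0 ∧ C.sum = 0 ∧ C ≠ B := by
        by_contra! hcon
        exact hA ⟨hB, h0, hcon⟩
      obtain ⟨C, hCB, hC0, hCs, hne⟩ := this
      obtain ⟨A, hAC, hA'⟩ := ih C (lt_of_le_of_ne hCB hne)
        ⟨fun g hg => hB.1 g (Multiset.mem_of_le hCB hg), hCs⟩ hC0
      exact ⟨A, hAC.trans hCB, hA'⟩

theorem exists_factorization {G : Type*} [AddCommGroup G] {S : Set G} (B : Multiset G)
    (hB : IsZeroSumSeq S B) :
    ∃ F : Multiset (Multiset G), (∀ A ∈ F, IsAtomSeq S A) ∧ F.sum = B := by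
  induction B using Multiset.strongInductionOn with
  | ih B ih =>
    by_cases h0 : B = 0
    · exact ⟨0, by simp, by simp [h0]⟩
    · obtain ⟨A, hAB, hA⟩ := exists_atomSeq_le B hB h0
      obtain ⟨C, rfl⟩ := Multiset.le_iff_exists_add.1 hAB
      have hC : IsZeroSumSeq S C := by
        refine ⟨fun g hg => hB.1 g (by simp [hg]), ?_⟩
        have := hB.2
        rwa [Multiset.sum_add, hA.1.2, zero_add] at this
      have hlt : C < A + C := by
        refine lt_of_le_of_ne (Multiset.le_add_left _ _) fun h => hA.2.1 ?_
        simpa using h.symm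
      obtain ⟨F, hF, hs⟩ := ih C hlt hC
      refine ⟨A ::ₘ F, ?_, by simp [hs]⟩
      intro X hX
      rcases Multiset.mem_cons.1 hX with rfl | hX
      exacts [hA, hF X hX]

theorem sInf_deltaSet_le {G : Type*} [AddCommGroup G] {S : Set G} {B : Multiset G}
    (hB : IsZeroSumSeq S B) {a b : ℕ} (ha : a ∈ LengthSet S B) (hb : b ∈ LengthSet S B)
    (hab : a < b) : sInf (DeltaSet S) ≤ b - a := by
  classical
  have hex : ∃ c, c ∈ LengthSet S B ∧ a < c := ⟨b, hb, hab⟩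
  have hmin := Nat.find_min' hex ⟨hb, hab⟩
  obtain ⟨h1, h2⟩ := Nat.find_spec hex
  have hd : Nat.find hex - a ∈ DeltaSet S :=
    ⟨B, hB, a, _, ha, h1, h2, rfl, fun c hc hac => Nat.find_min hex hac.2 ⟨hc, hac.1⟩⟩
  exact (Nat.sInf_le hd).trans (by omega)

theorem crossNum_add {G : Type*} [AddCommGroup G] (S T : Multiset G) :
    crossNum (S + T) = crossNum S + crossNum T := by
  simp [crossNum]

theorem crossNum_sum {G : Type*} [AddCommGroup G] (F : Multiset (Multiset G)) :
    crossNum F.sum = (F.map crossNum).sum := by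
  induction F using Multiset.induction with
  | empty => simp [crossNum]
  | cons A F ih => simp [crossNum_add, ih]

theorem card_eq_crossNum {G : Type*} [AddCommGroup G] {F : Multiset (Multiset G)}
    (h : ∀ A ∈ F, crossNum A = 1) : (F.card : ℚ) = crossNum F.sum := by
  rw [crossNum_sum, Multiset.map_congr rfl h]
  simp

theorem card_le_crossNum {G : Type*} [AddCommGroup G] {F : Multiset (Multiset G)}
    (h : ∀ A ∈ F, 1 ≤ crossNum A) : (F.card : ℚ) ≤ crossNum F.sum := by
  rw [crossNum_sum]
  simpa using Multiset.sum_map_le_sum_map (fun _ => (1 : ℚ)) crossNum h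

theorem card_lt_crossNum {G : Type*} [AddCommGroup G] {F : Multiset (Multiset G)}
    (h : ∀ A ∈ F, 1 ≤ crossNum A) {A : Multiset G} (hA : A ∈ F) (h1 : 1 < crossNum A) :
    (F.card : ℚ) < crossNum F.sum := by
  obtain ⟨F', rfl⟩ := Multiset.exists_cons_of_mem hA
  have := card_le_crossNum (F := F') fun X hX => h X (Multiset.mem_cons_of_mem hX)
  rw [Multiset.sum_cons, crossNum_add, Multiset.card_cons]
  push_cast
  linarith

theorem card_le_exponent_mul_crossNum {G : Type*} [AddCommGroup G] [Finite G]
    (Y : Multiset G) : (Y.card : ℚ) ≤ AddMonoid.exponent G * crossNum Y := by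
  have hn : 0 < AddMonoid.exponent G :=
    Nat.pos_of_ne_zero AddMonoid.exponent_ne_zero_of_finite
  have := Multiset.sum_map_le_sum_map (s := Y) (fun _ => (1 : ℚ) / AddMonoid.exponent G)
    (fun g => (1 : ℚ) / addOrderOf g) fun g _ => by
      refine one_div_le_one_div_of_le (by exact_mod_cast addOrderOf_pos g) ?_
      exact_mod_cast Nat.le_of_dvd hn (AddMonoid.addOrder_dvd_exponent g)
  have h2 : (Y.card : ℚ) * (1 / AddMonoid.exponent G) ≤ crossNum Y := by
    simpa [crossNum] using this
  have hq : (0 : ℚ) < AddMonoid.exponent G := by exact_mod_cast hn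
  rw [mul_one_div, div_le_iff₀ hq] at h2
  linarith

theorem card_le_sum_countP {α ι : Type*} (s : Finset ι) (p : ι → α → Prop)
    [∀ i, DecidablePred (p i)] (F : Multiset α) (h : ∀ U ∈ F, ∃ i ∈ s, p i U) :
    F.card ≤ ∑ i ∈ s, F.countP (p i) := by
  induction F using Multiset.induction with
  | empty => simp
  | cons U F ih =>
    obtain ⟨i, hi, hp⟩ := h U (by simp)
    have h1 := ih fun X hX => h X (Multiset.mem_cons_of_mem hX)
    have h2 : 1 ≤ ∑ i ∈ s, (if p i U then 1 else 0) := by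
      calc 1 = if p i U then 1 else 0 := by simp [hp]
        _ ≤ _ := Finset.single_le_sum (f := fun i => if p i U then 1 else 0)
            (fun _ _ => Nat.zero_le _) hi
    simp only [Multiset.card_cons, Multiset.countP_cons, Finset.sum_add_distrib]
    omega

theorem countP_mul_le_count_sum {α : Type*} [DecidableEq α] (F : Multiset (Multiset α)) (a : α)
    (q : ℕ) : F.countP (fun U => q < U.count a) * (q + 1) ≤ F.sum.count a := by
  induction F using Multiset.induction with
  | empty => simp
  | cons U F ih =>
    simp only [Multiset.countP_cons, Multiset.sum_cons, Multiset.count_add, add_mul]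
    split_ifs with h <;> omega

theorem two_mul_card_le {α : Type*} [DecidableEq α] {F : Multiset (Multiset α)}
    {B Y : Multiset α} (hF : F.sum = B + Y) (hY : ∀ a ∈ Y, a ∈ B) (hn : ∀ U ∈ F, ¬ U ≤ B) :
    2 * F.card ≤ Y.card + Y.toFinset.card := by
  have hex : ∀ U ∈ F, ∃ a ∈ Y.toFinset, B.count a < U.count a := by
    intro U hU
    have h1 := hn U hU
    rw [Multiset.le_iff_count] at h1
    push Not at h1
    obtain ⟨a, ha⟩ := h1
    refine ⟨a, ?_, ha⟩
    have h2 : U.count a ≤ F.sum.count a :=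
      Multiset.count_le_of_le _ (Multiset.single_le_sum (fun _ _ => Multiset.zero_le _) U hU)
    rw [hF, Multiset.count_add] at h2
    rw [Multiset.mem_toFinset, ← Multiset.count_pos]
    omega
  have h1 := card_le_sum_countP Y.toFinset (fun a U => B.count a < U.count a) F hex
  have h2 : ∀ a ∈ Y.toFinset,
      2 * F.countP (fun U => B.count a < U.count a) ≤ Y.count a + 1 := by
    intro a ha
    have h3 := countP_mul_le_count_sum F a (B.count a)
    rw [hF, Multiset.count_add] at h3
    have h4 : 0 < B.count a := Multiset.count_pos.2 (hY a (Multiset.mem_toFinset.1 ha))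
    generalize F.countP (fun U => B.count a < U.count a) = c at h3
    rcases Nat.eq_zero_or_pos c with rfl | hc
    · omega
    · nlinarith
  have h3 := Finset.sum_le_sum h2
  rw [← Finset.mul_sum, Finset.sum_add_distrib, Multiset.toFinset_sum_count_eq] at h3
  simp only [Finset.sum_const, smul_eq_mul, mul_one] at h3
  omega

theorem le_grank {G : Type*} [AddCommGroup G] [Finite G] {p k : ℕ} (hp : p.Prime)
    (f : (Fin k → ZMod p) →+ G) (hf : Function.Injective f) : k ≤ grank G := by
  refine le_csSup ⟨Nat.card G, ?_⟩ ⟨p, hp, f, hf⟩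
  rintro k ⟨p, hp, f, hf⟩
  have : NeZero p := ⟨hp.ne_zero⟩
  have h := Nat.card_le_card_of_injective f hf
  rw [Nat.card_fun, Nat.card_zmod, Nat.card_fin] at h
  exact (Nat.lt_pow_self hp.one_lt).le.trans h

theorem card_torsion_eq_card_quotient {K : Type*} [AddCommGroup K] [Finite K] (φ : K →+ K) :
    Nat.card φ.ker = Nat.card (K ⧸ φ.range) := by
  have ha := φ.ker.card_mul_index
  rw [AddSubgroup.index_ker] at ha
  have hb := φ.range.card_mul_index
  rw [AddSubgroup.index_eq_card] at hb
  refine Nat.eq_of_mul_eq_mul_left (Nat.card_pos (α := φ.range)) ?_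
  rw [hb, mul_comm, ha]

theorem finrank_le_grank {G V : Type*} [AddCommGroup G] [Finite G] [AddCommGroup V] [Finite V]
    {p : ℕ} [Fact p.Prime] [Module (ZMod p) V] (f : V →+ G) (hf : Function.Injective f) :
    Module.finrank (ZMod p) V ≤ grank G := by
  let e := (Module.finBasis (ZMod p) V).equivFun
  refine le_grank (Fact.out : p.Prime) (f.comp e.symm.toLinearMap.toAddMonoidHom) ?_
  exact hf.comp e.symm.injective

theorem finrank_quotient_le_grank {G : Type*} [AddCommGroup G] [Finite G] {p : ℕ}
    [Fact p.Prime] (K : AddSubgroup G) {Q : Type*} [AddCommGroup Q] [Finite Q] [Module (ZMod p) Q]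
    (hQ : Nat.card Q = Nat.card (nsmulAddMonoidHom (α := K) p).ker) :
    Module.finrank (ZMod p) Q ≤ grank G := by
  set V := (nsmulAddMonoidHom (α := K) p).ker
  let _ : Module (ZMod p) V := AddCommGroup.zmodModule (n := p) fun x => Subtype.ext x.2
  rw [← FiniteField.pow_finrank_eq_natCard p Q, ← FiniteField.pow_finrank_eq_natCard p V] at hQ
  rw [Nat.pow_right_injective (Fact.out : p.Prime).two_le hQ]
  exact finrank_le_grank (K.subtype.comp V.subtype)
    (K.subtype_injective.comp V.subtype_injective)

/-- The Burnside basis theorem for an elementary abelian quotient. -/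
theorem exists_finset_sub_mem_closure {K Q : Type*} [AddCommGroup K] [AddCommGroup Q] [Finite Q]
    {p : ℕ} [Fact p.Prime] [Module (ZMod p) Q] (π : K →+ Q) (hπ : Function.Surjective π)
    (T : Set K) (hT : AddSubgroup.closure T = ⊤) :
    ∃ E : Finset K, (E : Set K) ⊆ T ∧ E.card ≤ Module.finrank (ZMod p) Q ∧
      ∀ x, ∃ l ∈ AddSubgroup.closure (E : Set K), π l = π x := by
  classical
  obtain ⟨u, hu, hcard, hspan, -⟩ := Submodule.exists_finset_span_eq_linearIndepOn (ZMod p) (π '' T)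
  have htop : Submodule.span (ZMod p) (π '' T) = ⊤ := by
    rw [eq_top_iff]
    rintro x -
    obtain ⟨y, rfl⟩ := hπ x
    have hy : y ∈ AddSubgroup.closure T := hT ▸ AddSubgroup.mem_top y
    have : AddSubgroup.closure T ≤
        (Submodule.span (ZMod p) (π '' T)).toAddSubgroup.comap π := by
      rw [AddSubgroup.closure_le]
      exact fun t ht => Submodule.subset_span ⟨t, ht, rfl⟩
    exact this hy
  rw [htop, finrank_top] at hcard
  rw [htop] at hspan
  have hex : ∀ q ∈ u, ∃ k ∈ T, π k = q := fun q hq => hu hq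
  choose! s hsT hsπ using hex
  refine ⟨u.image s, ?_, Finset.card_image_le.trans hcard.le, fun x => ?_⟩
  · intro g hg
    simp only [Finset.coe_image, Set.mem_image] at hg
    obtain ⟨q, hq, rfl⟩ := hg
    exact hsT q hq
  · have hx : π x ∈ Submodule.span (ZMod p) (u : Set Q) := hspan ▸ Submodule.mem_top
    have hle : Submodule.span (ZMod p) (u : Set Q) ≤ AddSubgroup.toZModSubmodule p
        ((AddSubgroup.closure ((u.image s : Finset K) : Set K)).map π) := by
      rw [Submodule.span_le]
      intro q hq
      exact ⟨s q, AddSubgroup.subset_closure (by simpa using ⟨q, hq, rfl⟩), hsπ q hq⟩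
    exact hle hx

theorem exists_nsmul_mem_closure {G : Type*} [AddCommGroup G] [Finite G] {p : ℕ}
    (hp : p.Prime) (T : Set G) {z : G} (hz : z ∈ AddSubgroup.closure T) :
    ∃ E : Finset G, (E : Set G) ⊆ T ∧ E.card ≤ grank G ∧
      ∃ m : ℕ, ¬ p ∣ m ∧ m • z ∈ AddSubgroup.closure (E : Set G) := by
  classical
  have : Fact p.Prime := ⟨hp⟩
  set K := AddSubgroup.closure T
  let H := (nsmulAddMonoidHom (α := K) p).range
  let _ : Module (ZMod p) (K ⧸ H) :=
    QuotientAddGroup.zmodModule (n := p) fun x => ⟨x, rfl⟩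
  have hr : Module.finrank (ZMod p) (K ⧸ H) ≤ grank G :=
    finrank_quotient_le_grank K (card_torsion_eq_card_quotient _).symm
  obtain ⟨E', hE', hcard, hgen⟩ := exists_finset_sub_mem_closure (p := p) (QuotientAddGroup.mk' H)
    (QuotientAddGroup.mk'_surjective H) (((↑) : K → G) ⁻¹' T)
    AddSubgroup.closure_closure_coe_preimage
  let L := AddSubgroup.closure (E' : Set K)
  have hLH : ∀ x : K, ∃ y : K, x - p • y ∈ L := by
    intro x
    obtain ⟨l, hl, hlx⟩ := hgen x
    obtain ⟨y, hy⟩ : -l + x ∈ H := QuotientAddGroup.eq.1 hlx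
    refine ⟨y, ?_⟩
    have hy' : p • y = -l + x := hy
    rw [hy']
    simpa using hl
  refine ⟨E'.image (↑), ?_, ?_, Nat.card (K ⧸ L), ?_, ?_⟩
  · intro g hg
    simp only [Finset.coe_image, Set.mem_image] at hg
    obtain ⟨k, hk, rfl⟩ := hg
    exact hE' hk
  · exact Finset.card_image_le.trans (hcard.trans hr)
  · intro hdvd
    obtain ⟨x, hx⟩ := exists_prime_addOrderOf_dvd_card' p hdvd
    have hsurj : Function.Surjective (fun x : K ⧸ L => p • x) := by
      intro x
      obtain ⟨x, rfl⟩ := QuotientAddGroup.mk'_surjective L x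
      obtain ⟨y, hy⟩ := hLH x
      refine ⟨QuotientAddGroup.mk' L y, ?_⟩
      show p • QuotientAddGroup.mk' L y = _
      rw [← map_nsmul]
      refine QuotientAddGroup.eq.2 ?_
      rwa [neg_add_eq_sub]
    have hinj := Finite.injective_iff_surjective.2 hsurj
    have hx0 : x = 0 := hinj (by simp [← hx, addOrderOf_nsmul_eq_zero])
    rw [hx0, addOrderOf_zero] at hx
    exact hp.one_lt.ne hx
  · have h1 : Nat.card (K ⧸ L) • (⟨z, hz⟩ : K) ∈ L := by
      rw [← QuotientAddGroup.eq_zero_iff, QuotientAddGroup.mk_nsmul]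
      exact card_nsmul_eq_zero'
    have h2 : L.map K.subtype = AddSubgroup.closure ((E'.image (↑) : Finset G) : Set G) := by
      rw [AddMonoidHom.map_closure]
      simp
    rw [← h2]
    exact ⟨_, h1, rfl⟩

theorem exists_intFunction_of_mem_closure {G : Type*} [AddCommGroup G] [Fintype G] (E : Finset G)
    {z : G} (hz : z ∈ AddSubgroup.closure (E : Set G)) :
    ∃ c : G → ℤ, (∀ g ∉ E, c g = 0) ∧ ∑ g, c g • g = z := by
  rw [← Submodule.span_int_eq_addSubgroupClosure, Submodule.mem_toAddSubgroup,
    Submodule.mem_span_finset] at hz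
  obtain ⟨c, hc, hs⟩ := hz
  have hc' : ∀ g ∉ E, c g = 0 := fun g hg => by
    by_contra h
    exact hg (hc h)
  refine ⟨c, hc', ?_⟩
  rw [← hs]
  exact (Finset.sum_subset (Finset.subset_univ E) fun g _ hg => by rw [hc' g hg, zero_smul]).symm

/-- Integer relations among the elements of `T` are generated by those involving at most
`grank G + 1` elements. -/
theorem mem_closure_relations_of_card_support_le {G : Type*} [AddCommGroup G] [Fintype G]
    [DecidableEq G] (T : Finset G) (x : G → ℤ) (hx : ∀ g ∉ T, x g = 0) (hx0 : ∑ g, x g • g = 0) :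
    x ∈ AddSubgroup.closure {y : G → ℤ | (∀ g ∉ T, y g = 0) ∧ ∑ g, y g • g = 0 ∧
      (Finset.univ.filter fun g => y g ≠ 0).card ≤ grank G + 1} := by
  induction hk : T.card generalizing T x with
  | zero =>
    have : x = 0 := by
      rw [Finset.card_eq_zero] at hk
      ext g
      exact hx g (by simp [hk])
    rw [this]
    exact zero_mem _
  | succ k ih =>
    set C := AddSubgroup.closure {y : G → ℤ | (∀ g ∉ T, y g = 0) ∧ ∑ g, y g • g = 0 ∧
      (Finset.univ.filter fun g => y g ≠ 0).card ≤ grank G + 1}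
    obtain ⟨h, hT⟩ : T.Nonempty := Finset.card_pos.1 (by omega)
    let D : AddSubgroup ℤ :=
      (C.map (Pi.evalAddMonoidHom (fun _ : G => ℤ) h)).comap (AddMonoidHom.mulRight (x h))
    have hCT : ∀ y ∈ C, (∀ g ∉ T, y g = 0) ∧ ∑ g, y g • g = 0 := by
      intro y hy
      induction hy using AddSubgroup.closure_induction with
      | mem y hy => exact ⟨hy.1, hy.2.1⟩
      | zero => simp
      | add y z _ _ h1 h2 =>
        refine ⟨fun g hg => by simp [h1.1 g hg, h2.1 g hg], ?_⟩
        simp [add_smul, Finset.sum_add_distrib, h1.2, h2.2]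
      | neg y _ h1 =>
        refine ⟨fun g hg => by simp [h1.1 g hg], ?_⟩
        simp [h1.2]
    have hprime : ∀ p : ℕ, p.Prime → ∃ m : ℕ, ¬ p ∣ m ∧ (m : ℤ) ∈ D := by
      intro p hp
      have hz : x h • h ∈ AddSubgroup.closure ((T.erase h : Finset G) : Set G) := by
        have h1 : ∑ g ∈ T, x g • g = 0 := by
          rw [← hx0]
          exact Finset.sum_subset (Finset.subset_univ T) fun g _ hg => by rw [hx g hg, zero_smul]
        rw [← Finset.add_sum_erase T _ hT] at h1
        rw [eq_neg_of_add_eq_zero_left h1]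
        refine neg_mem (sum_mem fun g hg => ?_)
        exact zsmul_mem (AddSubgroup.subset_closure hg) _
      obtain ⟨E, hET, hEc, m, hpm, hm⟩ := exists_nsmul_mem_closure hp _ hz
      obtain ⟨c, hcE, hcs⟩ := exists_intFunction_of_mem_closure E hm
      have hE : ∀ g ∈ E, g ≠ h ∧ g ∈ T := fun g hg => by simpa [and_comm] using hET hg
      have hhE : h ∉ E := fun hh => (hE h hh).1 rfl
      refine ⟨m, hpm, Pi.single h (m * x h) - c, AddSubgroup.subset_closure ⟨?_, ?_, ?_⟩, ?_⟩
      · intro g hg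
        have h1 : g ≠ h := fun e => hg (e ▸ hT)
        have h2 : g ∉ E := fun e => hg (hE g e).2
        simp [h1, hcE g h2]
      · simp only [Pi.sub_apply, sub_smul, Finset.sum_sub_distrib, hcs]
        rw [Finset.sum_eq_single h (by intro g _ hg; simp [hg]) (by simp)]
        simp [mul_smul]
      · refine (Finset.card_le_card (t := insert h E) ?_).trans
          ((Finset.card_insert_le _ _).trans (by omega))
        intro g hg
        by_contra hgn
        rw [Finset.mem_insert, not_or] at hgn
        rw [Finset.mem_filter] at hg
        exact hg.2 (by simp [hgn.1, hcE g hgn.2])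
      · simp [hcE h hhE]
    have h1D : (1 : ℤ) ∈ D := by
      obtain ⟨a, ha⟩ := Int.subgroup_cyclic D
      rw [← AddSubgroup.zmultiples_eq_closure] at ha
      have ha1 : a.natAbs = 1 := by
        by_contra hne
        obtain ⟨p, hp, hpa⟩ := Nat.exists_prime_and_dvd hne
        obtain ⟨m, hpm, hm⟩ := hprime p hp
        rw [ha, Int.mem_zmultiples_iff] at hm
        exact hpm (Int.natCast_dvd_natCast.1 ((Int.natCast_dvd.2 hpa).trans hm))
      rw [ha, Int.mem_zmultiples_iff, ← Int.natAbs_dvd, ha1]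
      simp
    obtain ⟨y, hyC, hy⟩ := h1D
    have hyh : y h = x h := by simpa using hy
    have hmem : x - y ∈ C := by
      have := ih (T.erase h) (x - y) ?_ ?_ (by rw [Finset.card_erase_of_mem hT]; omega)
      · refine AddSubgroup.closure_mono ?_ this
        rintro w ⟨h1, h2⟩
        exact ⟨fun g hg => h1 g fun e => hg (Finset.mem_of_mem_erase e), h2⟩
      · intro g hg
        rcases eq_or_ne g h with rfl | hne
        · simp [hyh]
        · have : g ∉ T := fun e => hg (Finset.mem_erase.2 ⟨hne, e⟩)
          simp [hx g this, (hCT y hyC).1 g this]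
      · simp [sub_smul, Finset.sum_sub_distrib, hx0, (hCT y hyC).2]
    simpa using add_mem hmem hyC

theorem exists_small_factorization {G : Type*} [AddCommGroup G] [DecidableEq G] {S : Set G} {k : ℕ}
    {B : Multiset G} (hB : IsZeroSumSeq S B) (hk : B.toFinset.card ≤ k) :
    ∃ F : Multiset (Multiset G),
      (∀ A ∈ F, IsAtomSeq S A ∧ A.toFinset.card ≤ k) ∧ F.sum = B := by
  obtain ⟨F, hF, rfl⟩ := exists_factorization B hB
  refine ⟨F, fun A hA => ⟨hF A hA, (Finset.card_le_card ?_).trans hk⟩, rfl⟩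
  have : A ≤ F.sum := Multiset.single_le_sum (fun _ _ => Multiset.zero_le _) A hA
  exact Multiset.toFinset_subset.2 (Multiset.subset_of_le this)

theorem exists_multiset_count {G : Type*} [AddCommGroup G] [Fintype G] [DecidableEq G]
    (f : G → ℕ) : ∃ B : Multiset G, (∀ g, B.count g = f g) ∧ B.sum = ∑ g, f g • g := by
  refine ⟨∑ g, Multiset.replicate (f g) g, fun g => ?_, ?_⟩
  · simp [Multiset.count_sum', Multiset.count_replicate]
  · refine Finset.induction_on (Finset.univ : Finset G) (by simp) fun a s ha ih => ?_
    simp [Finset.sum_insert ha, ih]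

theorem exists_small_atoms_of_mem_closure {G : Type*} [AddCommGroup G] [Fintype G] [DecidableEq G]
    (T : Finset G) (k : ℕ) (x : G → ℤ)
    (hx : x ∈ AddSubgroup.closure {y : G → ℤ | (∀ g ∉ T, y g = 0) ∧ ∑ g, y g • g = 0 ∧
      (Finset.univ.filter fun g => y g ≠ 0).card ≤ k}) :
    ∃ F F' : Multiset (Multiset G),
      (∀ A ∈ F, IsAtomSeq (T : Set G) A ∧ A.toFinset.card ≤ k) ∧
      (∀ A ∈ F', IsAtomSeq (T : Set G) A ∧ A.toFinset.card ≤ k) ∧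
      ∀ g, x g + F.sum.count g = F'.sum.count g := by
  induction hx using AddSubgroup.closure_induction with
  | mem y hy =>
    obtain ⟨hT, hs, hc⟩ := hy
    have hN : ∀ g : G, Nat.card G • g = 0 := fun g => card_nsmul_eq_zero'
    have hpos : 0 < Nat.card G := Nat.card_pos
    have hsupp : ∀ (f : G → ℕ), (∀ g, y g = 0 → f g = 0) → ∑ g, f g • g = 0 →
        ∃ F : Multiset (Multiset G),
          (∀ A ∈ F, IsAtomSeq (T : Set G) A ∧ A.toFinset.card ≤ k) ∧
            ∀ g, F.sum.count g = f g := by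
      intro f hf hfs
      obtain ⟨B, hBc, hBs⟩ := exists_multiset_count f
      have hBy : ∀ g ∈ B, y g ≠ 0 := fun g hg h0 => by
        rw [← Multiset.count_pos, hBc, hf g h0] at hg
        exact lt_irrefl _ hg
      obtain ⟨F, hF, rfl⟩ := exists_small_factorization (S := (T : Set G)) (B := B) (k := k)
        ⟨fun g hg => by
          by_contra hgT
          exact hBy g hg (hT g hgT), hBs.trans hfs⟩
        ((Finset.card_le_card fun g hg => by
          simpa using hBy g (Multiset.mem_toFinset.1 hg)).trans hc)
      exact ⟨F, hF, hBc⟩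
    have hnn : ∀ g, 0 ≤ y g + Nat.card G * |y g| := fun g => by
      have h1 := neg_abs_le (y g)
      have h2 := abs_nonneg (y g)
      have h3 : (1 : ℤ) ≤ Nat.card G := by exact_mod_cast hpos
      nlinarith
    obtain ⟨F', hF', hc'⟩ := hsupp (fun g => (y g + Nat.card G * |y g|).toNat)
      (fun g hg => by simp [hg]) (by
        rw [← hs]
        refine Finset.sum_congr rfl fun g _ => ?_
        rw [← natCast_zsmul, Int.toNat_of_nonneg (hnn g), add_smul, mul_comm, mul_smul,
          natCast_zsmul, hN, smul_zero, add_zero])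
    obtain ⟨F, hF, hc''⟩ := hsupp (fun g => (y g).natAbs * Nat.card G)
      (fun g hg => by simp [hg])
      (Finset.sum_eq_zero fun g _ => by rw [mul_smul, hN, smul_zero])
    refine ⟨F, F', hF, hF', fun g => ?_⟩
    rw [hc', hc'', Int.toNat_of_nonneg (hnn g)]
    push_cast
    ring
  | zero => exact ⟨0, 0, by simp, by simp, by simp⟩
  | add y z _ _ h1 h2 =>
    obtain ⟨F₁, F₁', hF₁, hF₁', h1⟩ := h1
    obtain ⟨F₂, F₂', hF₂, hF₂', h2⟩ := h2
    refine ⟨F₁ + F₂, F₁' + F₂', ?_, ?_, fun g => ?_⟩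
    · intro A hA
      rcases Multiset.mem_add.1 hA with h | h
      exacts [hF₁ A h, hF₂ A h]
    · intro A hA
      rcases Multiset.mem_add.1 hA with h | h
      exacts [hF₁' A h, hF₂' A h]
    · simp only [Multiset.sum_add, Multiset.count_add, Pi.add_apply, Nat.cast_add]
      linarith [h1 g, h2 g]
  | neg y _ h1 =>
    obtain ⟨F, F', hF, hF', h1⟩ := h1
    refine ⟨F', F, hF', hF, fun g => ?_⟩
    rw [Pi.neg_apply]
    linarith [h1 g]

theorem exists_small_atoms_add_eq {G : Type*} [AddCommGroup G] [Fintype G] [DecidableEq G]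
    (T : Finset G) {A : Multiset G} (hA : IsZeroSumSeq (T : Set G) A) :
    ∃ F F' : Multiset (Multiset G),
      (∀ Y ∈ F, IsAtomSeq (T : Set G) Y ∧ Y.toFinset.card ≤ grank G + 1) ∧
      (∀ Y ∈ F', IsAtomSeq (T : Set G) Y ∧ Y.toFinset.card ≤ grank G + 1) ∧
      A + F.sum = F'.sum := by
  obtain ⟨F, F', hF, hF', h⟩ := exists_small_atoms_of_mem_closure T (grank G + 1)
    (fun g => (A.count g : ℤ)) (mem_closure_relations_of_card_support_le T _
      (fun g hg => by simpa using fun h => hg (hA.1 g h)) (by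
        simp only [natCast_zsmul]
        rw [← hA.2, Finset.sum_multiset_count A]
        refine (Finset.sum_subset (Finset.subset_univ _) fun g _ hg => ?_).symm
        rw [Multiset.mem_toFinset] at hg
        rw [Multiset.count_eq_zero_of_notMem hg, zero_smul]))
  refine ⟨F, F', hF, hF', ?_⟩
  ext g
  have := h g
  rw [Multiset.count_add]
  exact_mod_cast this

theorem IsZeroSumSeq.add {G : Type*} [AddCommGroup G] {S : Set G} {B C : Multiset G}
    (hB : IsZeroSumSeq S B) (hC : IsZeroSumSeq S C) : IsZeroSumSeq S (B + C) := by
  refine ⟨fun g hg => ?_, by rw [Multiset.sum_add, hB.2, hC.2, add_zero]⟩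
  rcases Multiset.mem_add.1 hg with h | h
  exacts [hB.1 g h, hC.1 g h]

theorem IsZeroSumSeq.sum {G : Type*} [AddCommGroup G] {S : Set G} {F : Multiset (Multiset G)}
    (hF : ∀ X ∈ F, IsZeroSumSeq S X) : IsZeroSumSeq S F.sum := by
  induction F using Multiset.induction with
  | empty => simp [IsZeroSumSeq]
  | cons X F ih =>
    rw [Multiset.sum_cons]
    exact (hF X (by simp)).add (ih fun Y hY => hF Y (Multiset.mem_cons_of_mem hY))

theorem isAtomSeq_replicate {G : Type*} [AddCommGroup G] [Finite G] {S : Set G} {g : G}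
    (hg : g ∈ S) : IsAtomSeq S (Multiset.replicate (addOrderOf g) g) := by
  refine ⟨⟨fun x hx => Multiset.eq_of_mem_replicate hx ▸ hg, by simp⟩, ?_, ?_⟩
  · rw [← Multiset.card_pos, Multiset.card_replicate]
    exact addOrderOf_pos g
  · intro B hB h0 hs
    obtain ⟨m, hm, rfl⟩ := Multiset.le_replicate_iff.1 hB
    rw [Multiset.sum_replicate] at hs
    have hm0 : 0 < m := Nat.pos_of_ne_zero fun h => h0 (by simp [h])
    rw [le_antisymm hm (Nat.le_of_dvd hm0 (addOrderOf_dvd_of_nsmul_eq_zero hs))]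

theorem crossNum_replicate {G : Type*} [AddCommGroup G] [Finite G] (g : G) :
    crossNum (Multiset.replicate (addOrderOf g) g) = 1 := by
  have : (addOrderOf g : ℚ) ≠ 0 := by exact_mod_cast (addOrderOf_pos g).ne'
  simp [crossNum, this]

theorem exists_atom_one_lt_crossNum {G : Type*} [AddCommGroup G] {S : Set G} (hS : IsLCNSet S)
    (hne : DeltaSet S ≠ ∅) : ∃ A, IsAtomSeq S A ∧ 1 < crossNum A := by
  obtain ⟨d, B, -, a, b, ⟨F, rfl, hF, hFB⟩, ⟨F', rfl, hF', hFB'⟩, hab, -⟩ :=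
    Set.nonempty_iff_ne_empty.2 hne
  by_contra! hcon
  have h1 := card_eq_crossNum fun A hA => le_antisymm (hcon A (hF A hA)) (hS A (hF A hA))
  have h2 := card_eq_crossNum fun A hA => le_antisymm (hcon A (hF' A hA)) (hS A (hF' A hA))
  rw [hFB, ← hFB', ← h2] at h1
  exact hab.ne (by exact_mod_cast h1)

theorem sInf_deltaSet_le_card_support {G : Type*} [AddCommGroup G] [Fintype G] [DecidableEq G]
    {S : Set G} (hS : IsLCNSet S) {A : Multiset G} (hA : IsAtomSeq S A) (h1 : 1 < crossNum A) :
    sInf (DeltaSet S) ≤ A.toFinset.card - 2 := by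
  have hlt : ∀ g, A.count g < addOrderOf g := by
    intro g
    by_contra! hle
    have hrep := Multiset.le_count_iff_replicate_le.1 hle
    have hgA : g ∈ A := Multiset.count_pos.1 ((addOrderOf_pos g).trans_le hle)
    have hat := isAtomSeq_replicate (hA.1.1 g hgA)
    rw [← hA.2.2 _ hrep hat.2.1 hat.1.2, crossNum_replicate] at h1
    exact lt_irrefl _ h1
  let U := A.toFinset.val.map fun g => Multiset.replicate (addOrderOf g) g
  have hU : ∀ X ∈ U, IsAtomSeq S X ∧ crossNum X = 1 := by
    intro X hX
    obtain ⟨g, hg, rfl⟩ := Multiset.mem_map.1 hX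
    exact ⟨isAtomSeq_replicate (hA.1.1 g (Multiset.mem_toFinset.1 hg)), crossNum_replicate g⟩
  have hUc : U.card = A.toFinset.card := Multiset.card_map _ _
  have hUcount : ∀ g, U.sum.count g = if g ∈ A then addOrderOf g else 0 := by
    intro g
    change (∑ x ∈ A.toFinset, Multiset.replicate (addOrderOf x) x).count g = _
    simp [Multiset.count_sum', Multiset.count_replicate]
  obtain ⟨C, hC⟩ := Multiset.le_iff_exists_add.1 (show A ≤ U.sum from by
    rw [Multiset.le_iff_count]
    intro g
    rw [hUcount]
    split_ifs with hg
    · exact (hlt g).le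
    · rw [Multiset.count_eq_zero_of_notMem hg])
  have hUz : IsZeroSumSeq S U.sum := IsZeroSumSeq.sum fun X hX => (hU X hX).1.1
  have hCz : IsZeroSumSeq S C := by
    refine ⟨fun g hg => hUz.1 g (by simp [hC, hg]), ?_⟩
    have := hUz.2
    rwa [hC, Multiset.sum_add, hA.1.2, zero_add] at this
  obtain ⟨F, hF, rfl⟩ := exists_factorization C hCz
  have hFpos : 0 < F.card := by
    rw [Multiset.card_pos]
    rintro rfl
    obtain ⟨g, hg⟩ := Multiset.exists_mem_of_ne_zero hA.2.1
    have h2 := hUcount g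
    rw [hC, if_pos hg] at h2
    simp only [Multiset.sum_zero, add_zero] at h2
    exact (hlt g).ne h2
  have hFk := card_le_crossNum fun X hX => hS X (hF X hX)
  have hUk := card_eq_crossNum fun X hX => (hU X hX).2
  rw [hC, crossNum_add] at hUk
  have hcard : F.card + 1 < U.card := by
    have : (F.card : ℚ) + 1 < U.card := by linarith
    exact_mod_cast this
  have := sInf_deltaSet_le hUz (a := F.card + 1) (b := U.card)
    ⟨A ::ₘ F, by simp, fun X hX => by
      rcases Multiset.mem_cons.1 hX with rfl | hX
      exacts [hA, hF X hX], by simp [hC]⟩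
    ⟨U, rfl, fun X hX => (hU X hX).1, rfl⟩ hcard
  omega

/-- A sequence with a factorization into atoms of cross number one. -/
def HasUnitFactorization {G : Type*} [AddCommGroup G] (S : Set G) (B : Multiset G) : Prop :=
  ∃ F : Multiset (Multiset G), (∀ U ∈ F, IsAtomSeq S U ∧ crossNum U = 1) ∧ F.sum = B

theorem exists_minimal_of_add_sum {M : Type*} [AddCommMonoid M] (P Q : M → Prop) (F : Multiset M)
    {a : M} (ha : ¬ P a) (hQ : ∀ y ∈ F, Q y) (h : P (a + F.sum)) :
    ∃ F' y, F' + {y} ≤ F ∧ Q y ∧ ¬ P (a + F'.sum) ∧ P (a + F'.sum + y) := by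
  induction F using Multiset.induction with
  | empty => simp [ha] at h
  | cons y F ih =>
    by_cases hF : P (a + F.sum)
    · obtain ⟨F', z, hle, hz⟩ := ih (fun y hy => hQ y (Multiset.mem_cons_of_mem hy)) hF
      exact ⟨F', z, hle.trans (Multiset.le_cons_self _ _), hz⟩
    · refine ⟨F, y, by rw [add_comm, Multiset.singleton_add], hQ y (by simp), hF, ?_⟩
      rwa [Multiset.sum_cons, add_left_comm, add_comm] at h

theorem sInf_deltaSet_le_of_lt_card_support {G : Type*} [AddCommGroup G] [Fintype G]
    [DecidableEq G] {S : Set G} (hS : IsLCNSet S) {A : Multiset G} (hA : IsAtomSeq S A)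
    (h1 : 1 < crossNum A)
    (hmin : ∀ A', IsAtomSeq S A' → 1 < crossNum A' → A.toFinset.card ≤ A'.toFinset.card)
    (hr : grank G + 1 < A.toFinset.card) :
    2 * sInf (DeltaSet S) + 3 ≤ AddMonoid.exponent G + grank G := by
  classical
  set T := A.toFinset
  have hTS : (T : Set G) ⊆ S := fun g hg => hA.1.1 g (Multiset.mem_toFinset.1 hg)
  have hunit : ∀ Y, IsAtomSeq (T : Set G) Y ∧ Y.toFinset.card ≤ grank G + 1 →
      IsAtomSeq S Y ∧ crossNum Y = 1 := by
    rintro Y ⟨hY, hc⟩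
    have hYS := hY.mono hTS
    refine ⟨hYS, le_antisymm ?_ (hS Y hYS)⟩
    by_contra! hlt
    have := hmin Y hYS hlt
    omega
  have hAT : IsZeroSumSeq (T : Set G) A := ⟨fun g hg => Multiset.mem_toFinset.2 hg, hA.1.2⟩
  have hAn : ¬ HasUnitFactorization S A := by
    rintro ⟨F, hF, hs⟩
    have h0 : F ≠ 0 := by
      rintro rfl
      exact hA.2.1 hs.symm
    obtain ⟨U, hU⟩ := Multiset.exists_mem_of_ne_zero h0
    have hle : U ≤ A := hs ▸ Multiset.single_le_sum (fun _ _ => Multiset.zero_le _) U hU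
    rw [← hA.2.2 U hle (hF U hU).1.2.1 (hF U hU).1.1.2, (hF U hU).2] at h1
    exact lt_irrefl _ h1
  have hex : ∃ m, ∃ B Y : Multiset G, B.card = m ∧ IsZeroSumSeq (T : Set G) B ∧
      (IsAtomSeq (T : Set G) Y ∧ Y.toFinset.card ≤ grank G + 1) ∧
      ¬ HasUnitFactorization S B ∧ HasUnitFactorization S (B + Y) := by
    obtain ⟨F, F', hF, hF', hFF⟩ := exists_small_atoms_add_eq T hAT
    obtain ⟨F₁, Y, hle, hY, hn, hg⟩ := exists_minimal_of_add_sum (HasUnitFactorization S)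
      (fun Y => IsAtomSeq (T : Set G) Y ∧ Y.toFinset.card ≤ grank G + 1) F hAn hF
      ⟨F', fun U hU => hunit U (hF' U hU), hFF.symm⟩
    refine ⟨_, A + F₁.sum, Y, rfl, ?_, hY, hn, hg⟩
    have hF₁ : ∀ X ∈ F₁, IsZeroSumSeq (T : Set G) X := fun X hX =>
      (hF X (Multiset.mem_of_le hle (by simp [hX]))).1.1
    exact hAT.add (IsZeroSumSeq.sum hF₁)
  obtain ⟨B, Y, hBm, hBT, hY, hBn, F, hF, hFs⟩ := Nat.find_spec hex
  have hle : ∀ U ∈ F, ¬ U ≤ B := by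
    intro U hU hUB
    obtain ⟨B', rfl⟩ := Multiset.le_iff_exists_add.1 hUB
    obtain ⟨F', rfl⟩ := Multiset.exists_cons_of_mem hU
    have hcard : 0 < U.card := Multiset.card_pos.2 (hF U hU).1.2.1
    refine Nat.find_min hex (m := B'.card) ?_ ⟨B', Y, rfl, ⟨fun g hg => hBT.1 g (by simp [hg]), ?_⟩,
      hY, ?_, F', fun X hX => hF X (Multiset.mem_cons_of_mem hX), ?_⟩
    · rw [← hBm, Multiset.card_add]
      omega
    · have := hBT.2
      rwa [Multiset.sum_add, (hF U hU).1.1.2, zero_add] at this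
    · rintro ⟨F'', hF'', rfl⟩
      refine hBn ⟨U ::ₘ F'', fun X hX => ?_, by simp⟩
      rcases Multiset.mem_cons.1 hX with rfl | hX
      exacts [hF X hU, hF'' X hX]
    · rw [Multiset.sum_cons, add_assoc] at hFs
      exact add_left_cancel hFs
  obtain ⟨F', hF', hFs'⟩ := exists_factorization B ⟨fun g hg => hTS (hBT.1 g hg), hBT.2⟩
  have hUex : ∃ U ∈ F', 1 < crossNum U := by
    by_contra! hcon
    exact hBn ⟨F', fun U hU => ⟨hF' U hU, le_antisymm (hcon U hU) (hS U (hF' U hU))⟩, hFs'⟩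
  obtain ⟨W, hW, hW1⟩ := hUex
  have hWB : W ≤ B := hFs' ▸ Multiset.single_le_sum (fun _ _ => Multiset.zero_le _) W hW
  have hWT : W.toFinset = T := by
    refine Finset.eq_of_subset_of_card_le (fun g hg => ?_) (hmin W (hF' W hW) hW1)
    exact hBT.1 g (Multiset.mem_of_le hWB (Multiset.mem_toFinset.1 hg))
  have hYB : ∀ g ∈ Y, g ∈ B := fun g hg => by
    have : g ∈ T := hY.1.1.1 g hg
    rw [← hWT, Multiset.mem_toFinset] at this
    exact Multiset.mem_of_le hWB this
  have hcount := two_mul_card_le hFs hYB hle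
  obtain ⟨hYS, hYk⟩ := hunit Y hY
  have hYcard : Y.card ≤ AddMonoid.exponent G := by
    have := card_le_exponent_mul_crossNum Y
    rw [hYk, mul_one] at this
    exact_mod_cast this
  have hFk := card_eq_crossNum fun U hU => (hF U hU).2
  have hFk' := card_lt_crossNum (fun U hU => hS U (hF' U hU)) hW hW1
  rw [hFs, crossNum_add, hYk] at hFk
  rw [hFs'] at hFk'
  have hlt : F'.card + 1 < F.card := by
    have : (F'.card : ℚ) + 1 < F.card := by linarith
    exact_mod_cast this
  have hpos : 0 < F'.card := Multiset.card_pos_iff_exists_mem.2 ⟨W, hW⟩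
  have hBY : IsZeroSumSeq S (B + Y) :=
    IsZeroSumSeq.add ⟨fun g hg => hTS (hBT.1 g hg), hBT.2⟩ hYS.1
  have hd := sInf_deltaSet_le hBY (a := F'.card + 1) (b := F.card)
    ⟨Y ::ₘ F', by simp, fun X hX => by
      rcases Multiset.mem_cons.1 hX with rfl | hX
      exacts [hYS, hF' X hX], by rw [Multiset.sum_cons, hFs', add_comm]⟩
    ⟨F, rfl, fun X hX => (hF X hX).1, hFs⟩ hlt
  have hYs := hY.2
  omega

theorem mConst_le {G : Type*} [AddCommGroup G] [Fintype G] :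
    mConst G ≤ max (grank G - 1) ((AddMonoid.exponent G + grank G - 3) / 2) := by
  classical
  refine csSup_le' ?_
  rintro _ ⟨S, hS, hne, rfl⟩
  have hex : ∃ m, ∃ A, IsAtomSeq S A ∧ 1 < crossNum A ∧ A.toFinset.card = m := by
    obtain ⟨A, hA, h1⟩ := exists_atom_one_lt_crossNum hS hne
    exact ⟨_, A, hA, h1, rfl⟩
  obtain ⟨A, hA, h1, hm⟩ := Nat.find_spec hex
  have hmin : ∀ A', IsAtomSeq S A' → 1 < crossNum A' → A.toFinset.card ≤ A'.toFinset.card :=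
    fun A' hA' h1' => hm ▸ Nat.find_min' hex ⟨A', hA', h1', rfl⟩
  rcases le_or_gt A.toFinset.card (grank G + 1) with hr | hr
  · have := sInf_deltaSet_le_card_support hS hA h1
    exact le_max_of_le_left (by omega)
  · have := sInf_deltaSet_le_of_lt_card_support hS hA h1 hmin hr
    exact le_max_of_le_right (by omega)

theorem one_le_grank {G : Type*} [AddCommGroup G] [Finite G] [Nontrivial G] : 1 ≤ grank G := by
  obtain ⟨p, hp, hdvd⟩ := Nat.exists_prime_and_dvd (Finite.one_lt_card (α := G)).ne'
  have : Fact p.Prime := ⟨hp⟩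
  obtain ⟨x, hx⟩ := exists_prime_addOrderOf_dvd_card' p hdvd
  let f : ZMod p →+ G := ZMod.lift p ⟨zmultiplesHom G x, by simp [← hx, addOrderOf_nsmul_eq_zero]⟩
  have hf : Function.Injective f := by
    rw [ZMod.lift_injective]
    intro m hm
    rw [ZMod.intCast_zmod_eq_zero_iff_dvd, ← hx]
    exact addOrderOf_dvd_iff_zsmul_eq_zero.2 (by simpa using hm)
  refine le_grank (k := 1) hp (f.comp (Pi.evalAddMonoidHom (fun _ : Fin 1 => ZMod p) 0)) ?_
  refine hf.comp fun a b hab => funext fun i => ?_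
  rwa [Subsingleton.elim i 0]

theorem stmt_12 {G : Type*} [AddCommGroup G] [Fintype G] (n r : ℕ)
    (hn : AddMonoid.exponent G = n) (h3 : 3 ≤ n) (hr : grank G = r) :
    (mConst G : ℚ) ≤ min ((n : ℚ) / 2 + r - 2)
      (max ((r : ℚ) - 1) (max (5 * (n : ℚ) / 6 - 4) (((n : ℚ) + r - 3) / 2))) := by
  have hnt : Nontrivial G := by
    rw [← not_subsingleton_iff_nontrivial]
    intro hs
    have := AddMonoid.exp_eq_one_iff.2 hs
    omega
  have h1 : 1 ≤ r := hr ▸ one_le_grank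
  have h := mConst_le (G := G)
  rw [hn, hr] at h
  have h1q : (1 : ℚ) ≤ r := by exact_mod_cast h1
  have h3q : (3 : ℚ) ≤ n := by exact_mod_cast h3
  have hcase : mConst G + 1 ≤ r ∨ 2 * mConst G + 3 ≤ n + r := by
    rcases le_max_iff.1 h with h | h <;> omega
  rcases hcase with h | h
  · have hq : (mConst G : ℚ) + 1 ≤ r := by exact_mod_cast h
    refine le_min (by linarith) (le_max_of_le_left (by linarith))
  · have hq : 2 * (mConst G : ℚ) + 3 ≤ n + r := by exact_mod_cast h
    refine le_min (by linarith) (le_max_of_le_right (le_max_of_le_right (by linarith)))
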